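/- arXiv:2409.08531 — 14 statements merged into one kernel-verified Lean document; each statement's English description precedes it below -/
import Mathlib

section
/- Suppose f : ℝ → ℝ, and for each n ∈ {0,…,Nt−1} the periodic grid functions u⁰, uⁿ, uⁿ¹, uⁿ², uⁿ³, uⁿ⁺¹ and source values Sⁿ : ZMod N → ℝ satisfy the Strang-HOC scheme: (i) H₁ uⁿ¹ = H₂ uⁿ; (ii) B uⁿ² = B uⁿ¹ − τ·D(f∘uⁿ¹) + τ·B Sⁿ; (iii) B uⁿ³ = B uⁿ¹ − (τ/2)·D(f∘uⁿ¹ + f∘uⁿ²) + (τ/2)·B(Sⁿ + Sⁿ⁺¹); (iv) H₁ uⁿ⁺¹ = H₂ uⁿ³. Then for every n ∈ {0,…,Nt−1}, Σ_i h·uⁿ⁺¹(i) = Σ_i h·u⁰(i) + (τ/2)·Σ_{k=0}^{n} Σ_i h·(Sᵏ(i) + Sᵏ⁺¹(i)) (discrete mass conservation). -/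
noncomputable def Aop {N : ℕ} (u : ZMod N → ℝ) : ZMod N → ℝ :=
  fun i => (u (i - 1) + 10 * u i + u (i + 1)) / 12

noncomputable def Bop {N : ℕ} (u : ZMod N → ℝ) : ZMod N → ℝ :=
  fun i => (u (i - 1) + 4 * u i + u (i + 1)) / 6

noncomputable def d2op {N : ℕ} (h : ℝ) (u : ZMod N → ℝ) : ZMod N → ℝ :=
  fun i => (u (i + 1) - 2 * u i + u (i - 1)) / h ^ 2

noncomputable def Dop {N : ℕ} (h : ℝ) (u : ZMod N → ℝ) : ZMod N → ℝ :=
  fun i => (u (i + 1) - u (i - 1)) / (2 * h)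

noncomputable def H1op {N : ℕ} (ν τ h : ℝ) (u : ZMod N → ℝ) : ZMod N → ℝ :=
  fun i => Aop u i - (ν * τ / 4) * d2op h u i

noncomputable def H2op {N : ℕ} (ν τ h : ℝ) (u : ZMod N → ℝ) : ZMod N → ℝ :=
  fun i => Aop u i + (ν * τ / 4) * d2op h u i

theorem sum_shift_add {N : ℕ} [NeZero N] (u : ZMod N → ℝ) :
    ∑ i, u (i + 1) = ∑ i, u i :=
  Equiv.sum_comp (Equiv.addRight (1 : ZMod N)) u

theorem sum_shift_sub {N : ℕ} [NeZero N] (u : ZMod N → ℝ) :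
    ∑ i, u (i - 1) = ∑ i, u i :=
  Equiv.sum_comp (Equiv.subRight (1 : ZMod N)) u

theorem sum_Aop {N : ℕ} [NeZero N] (u : ZMod N → ℝ) :
    ∑ i, Aop u i = ∑ i, u i := by
  simp only [Aop, ← Finset.sum_div, Finset.sum_add_distrib, ← Finset.mul_sum,
    sum_shift_add, sum_shift_sub]
  ring

theorem sum_Bop {N : ℕ} [NeZero N] (u : ZMod N → ℝ) :
    ∑ i, Bop u i = ∑ i, u i := by
  simp only [Bop, ← Finset.sum_div, Finset.sum_add_distrib, ← Finset.mul_sum,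
    sum_shift_add, sum_shift_sub]
  ring

theorem sum_d2op {N : ℕ} [NeZero N] (h : ℝ) (u : ZMod N → ℝ) :
    ∑ i, d2op h u i = 0 := by
  simp only [d2op, ← Finset.sum_div, Finset.sum_add_distrib, Finset.sum_sub_distrib,
    ← Finset.mul_sum, sum_shift_add, sum_shift_sub]
  ring

theorem sum_Dop {N : ℕ} [NeZero N] (h : ℝ) (u : ZMod N → ℝ) :
    ∑ i, Dop h u i = 0 := by
  simp only [Dop, ← Finset.sum_div, Finset.sum_sub_distrib, sum_shift_add, sum_shift_sub]
  ring

theorem sum_H1op {N : ℕ} [NeZero N] (ν τ h : ℝ) (u : ZMod N → ℝ) :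
    ∑ i, H1op ν τ h u i = ∑ i, u i := by
  simp only [H1op, Finset.sum_sub_distrib, ← Finset.mul_sum, sum_Aop, sum_d2op]
  ring

theorem sum_H2op {N : ℕ} [NeZero N] (ν τ h : ℝ) (u : ZMod N → ℝ) :
    ∑ i, H2op ν τ h u i = ∑ i, u i := by
  simp only [H2op, Finset.sum_add_distrib, ← Finset.mul_sum, sum_Aop, sum_d2op]
  ring

theorem strang_hoc_discrete_mass_conservation
    (N Nt : ℕ) [NeZero N] (hNt : 0 < Nt)
    (h τ ν : ℝ) (hh : 0 < h) (hτ : 0 < τ) (hν : 0 < ν)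
    (f : ℝ → ℝ)
    (u u1 u2 u3 S : ℕ → ZMod N → ℝ)
    (hstep1 : ∀ n < Nt, ∀ i : ZMod N,
      H1op ν τ h (u1 n) i = H2op ν τ h (u n) i)
    (hstep2 : ∀ n < Nt, ∀ i : ZMod N,
      Bop (u2 n) i = Bop (u1 n) i - τ * Dop h (fun j => f (u1 n j)) i
        + τ * Bop (S n) i)
    (hstep3 : ∀ n < Nt, ∀ i : ZMod N,
      Bop (u3 n) i = Bop (u1 n) i
        - (τ / 2) * Dop h (fun j => f (u1 n j) + f (u2 n j)) i
        + (τ / 2) * Bop (fun j => S n j + S (n + 1) j) i)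
    (hstep4 : ∀ n < Nt, ∀ i : ZMod N,
      H1op ν τ h (u (n + 1)) i = H2op ν τ h (u3 n) i) :
    ∀ n < Nt,
      ∑ i : ZMod N, h * u (n + 1) i
        = ∑ i : ZMod N, h * u 0 i
          + (τ / 2) * ∑ k ∈ Finset.range (n + 1),
              ∑ i : ZMod N, h * (S k i + S (k + 1) i) := by
  have step : ∀ n < Nt, ∑ i : ZMod N, u (n + 1) i
      = ∑ i : ZMod N, u n i + (τ / 2) * ∑ i : ZMod N, (S n i + S (n + 1) i) := by
    intro n hn
    have e1 := Finset.sum_congr (rfl : (Finset.univ : Finset (ZMod N)) = Finset.univ)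
      (fun i _ => hstep1 n hn i)
    have e3 := Finset.sum_congr (rfl : (Finset.univ : Finset (ZMod N)) = Finset.univ)
      (fun i _ => hstep3 n hn i)
    have e4 := Finset.sum_congr (rfl : (Finset.univ : Finset (ZMod N)) = Finset.univ)
      (fun i _ => hstep4 n hn i)
    rw [sum_H1op, sum_H2op] at e1 e4
    rw [Finset.sum_add_distrib, Finset.sum_sub_distrib, ← Finset.mul_sum, ← Finset.mul_sum,
      sum_Dop, sum_Bop, sum_Bop, sum_Bop] at e3
    rw [e4, e3, e1]
    ring
  intro n
  induction n with
  | zero =>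
    intro hn
    have := step 0 hn
    simp only [← Finset.mul_sum, Finset.sum_range_succ, Finset.sum_range_zero]
    rw [this]
    ring
  | succ n ih =>
    intro hn
    have h1 := ih (by omega)
    have h2 := step (n + 1) hn
    rw [Finset.sum_range_succ, mul_add, ← add_assoc, ← h1]
    simp only [← Finset.mul_sum]
    rw [h2]
    ring
end

section
/- Let N be a positive integer, α, β ≥ 0 with α + β ≤ 1, and let u, w : ZMod N → ℝ satisfy, for every i (indices modulo N), −α·u(i−1) + (1 + α + β)·u(i) − β·u(i+1) = w(i). If m ≤ w(i) ≤ M for all i, then m ≤ u(i) ≤ M for all i. -/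
theorem tridiagonal_M_matrix_bound_preserving
    (N : ℕ) [NeZero N] (α β m M : ℝ)
    (hα : 0 ≤ α) (hβ : 0 ≤ β) (hαβ : α + β ≤ 1)
    (u w : ZMod N → ℝ)
    (hscheme : ∀ i : ZMod N,
      -α * u (i - 1) + (1 + α + β) * u i - β * u (i + 1) = w i)
    (hw : ∀ i : ZMod N, m ≤ w i ∧ w i ≤ M) :
    ∀ i : ZMod N, m ≤ u i ∧ u i ≤ M := by
  intro i
  obtain ⟨a, ha⟩ := Finite.exists_min u
  obtain ⟨b, hb⟩ := Finite.exists_max u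
  have h1 := mul_le_mul_of_nonneg_left (ha (a - 1)) hα
  have h2 := mul_le_mul_of_nonneg_left (ha (a + 1)) hβ
  have h3 := mul_le_mul_of_nonneg_left (hb (b - 1)) hα
  have h4 := mul_le_mul_of_nonneg_left (hb (b + 1)) hβ
  have h5 := hscheme a
  have h6 := hscheme b
  constructor
  · linarith [ha i, (hw a).1]
  · linarith [hb i, (hw b).2]
end

section
/- Suppose 0 < ν·μ ≤ 5/3 and let u : ZMod N → ℝ satisfy m ≤ u(i) ≤ M for all i. Then for every i, m ≤ (H₂ u)(i) ≤ M, where (H₂ u)(i) = ((1+3νμ)·u(i−1) + (10−6νμ)·u(i) + (1+3νμ)·u(i+1))/12. -/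
theorem H2_weak_monotonicity_bound_preserving
    (N : ℕ) [NeZero N] (h τ ν m M : ℝ)
    (hh : 0 < h) (hτ : 0 < τ) (hν : 0 < ν)
    (hμ : ν * (τ / h ^ 2) ≤ 5 / 3)
    (u : ZMod N → ℝ) (hu : ∀ i : ZMod N, m ≤ u i ∧ u i ≤ M) :
    ∀ i : ZMod N, m ≤ H2op ν τ h u i ∧ H2op ν τ h u i ≤ M := by
  intro i
  have hk : 0 < ν * (τ / h ^ 2) := by positivity
  have e : H2op ν τ h u i = ((1 + 3 * (ν * (τ / h ^ 2))) * u (i - 1)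
      + (10 - 6 * (ν * (τ / h ^ 2))) * u i + (1 + 3 * (ν * (τ / h ^ 2))) * u (i + 1)) / 12 := by
    simp only [H2op, Aop, d2op]
    ring
  rw [e]
  generalize ν * (τ / h ^ 2) = k at hμ hk
  have h1 : 0 ≤ 1 + 3 * k := by linarith
  have h2 : 0 ≤ 10 - 6 * k := by linarith
  obtain ⟨a1, a2⟩ := hu (i - 1)
  obtain ⟨b1, b2⟩ := hu i
  obtain ⟨c1, c2⟩ := hu (i + 1)
  constructor
  · linarith [mul_le_mul_of_nonneg_left a1 h1, mul_le_mul_of_nonneg_left b1 h2,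
      mul_le_mul_of_nonneg_left c1 h1]
  · linarith [mul_le_mul_of_nonneg_left a2 h1, mul_le_mul_of_nonneg_left b2 h2,
      mul_le_mul_of_nonneg_left c2 h1]
end

section
/- Suppose ν·μ ≥ 1/3, and let u, w : ZMod N → ℝ satisfy H₁ u = w, i.e. ((1−3νμ)·u(i−1) + (10+6νμ)·u(i) + (1−3νμ)·u(i+1))/12 = w(i) for all i. If m ≤ w(i) ≤ M for all i, then m ≤ u(i) ≤ M for all i. -/
theorem H1_inverse_bound_preserving
    (N : ℕ) [NeZero N] (h τ ν m M : ℝ)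
    (hh : 0 < h) (hτ : 0 < τ) (hν : 0 < ν)
    (hμ : 1 / 3 ≤ ν * (τ / h ^ 2))
    (u w : ZMod N → ℝ)
    (hscheme : ∀ i : ZMod N, H1op ν τ h u i = w i)
    (hw : ∀ i : ZMod N, m ≤ w i ∧ w i ≤ M) :
    ∀ i : ZMod N, m ≤ u i ∧ u i ≤ M := by
  have key : ∀ i : ZMod N,
      w i = u i + (3 * (ν * (τ / h ^ 2)) - 1) * ((u i - u (i - 1)) + (u i - u (i + 1))) / 12 := by
    intro i
    rw [← hscheme i]
    simp only [H1op, Aop, d2op]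
    ring
  have hc : 0 ≤ 3 * (ν * (τ / h ^ 2)) - 1 := by linarith
  obtain ⟨a, ha⟩ := Finite.exists_max u
  obtain ⟨b, hb⟩ := Finite.exists_min u
  have h1 : u a ≤ M := by
    have h2 := mul_nonneg hc
      (add_nonneg (sub_nonneg.2 (ha (a - 1))) (sub_nonneg.2 (ha (a + 1))))
    linarith [key a, (hw a).2]
  have h3 : m ≤ u b := by
    have h2 := mul_nonpos_of_nonneg_of_nonpos hc
      (add_nonpos (sub_nonpos.2 (hb (b - 1))) (sub_nonpos.2 (hb (b + 1))))
    linarith [key b, (hw b).1]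
  exact fun i => ⟨h3.trans (hb i), (ha i).trans h1⟩
end

section
/- Suppose 1/3 ≤ ν·μ ≤ 5/3, and let u, v : ZMod N → ℝ satisfy the compact Crank–Nicolson diffusion half-step H₁ v = H₂ u. If m ≤ u(i) ≤ M for all i, then m ≤ v(i) ≤ M for all i (the diffusion half-step is bound-preserving without any limiter in this regime). -/
theorem diffusion_half_step_bound_preserving
    (N : ℕ) [NeZero N] (h τ ν m M : ℝ)
    (hh : 0 < h) (hτ : 0 < τ) (hν : 0 < ν)
    (hμ1 : 1 / 3 ≤ ν * (τ / h ^ 2)) (hμ2 : ν * (τ / h ^ 2) ≤ 5 / 3)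
    (u v : ZMod N → ℝ)
    (hscheme : ∀ i : ZMod N, H1op ν τ h v i = H2op ν τ h u i)
    (hu : ∀ i : ZMod N, m ≤ u i ∧ u i ≤ M) :
    ∀ i : ZMod N, m ≤ v i ∧ v i ≤ M := by
  set k := ν * (τ / h ^ 2) with hk
  have key : ∀ i, (1 - 3 * k) * v (i - 1) + (10 + 6 * k) * v i + (1 - 3 * k) * v (i + 1)
      = (1 + 3 * k) * u (i - 1) + (10 - 6 * k) * u i + (1 + 3 * k) * u (i + 1) := by
    intro i
    have e := hscheme i
    simp only [H1op, H2op, Aop, d2op] at e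
    have r : ∀ x : ℝ, ν * τ / 4 * (x / h ^ 2) = k * x / 4 := by
      intro x
      rw [hk]
      ring
    rw [r, r] at e
    linarith
  have h1 : 0 ≤ 3 * k - 1 := by linarith
  have h2 : 0 ≤ 10 - 6 * k := by linarith
  have h3 : 0 ≤ 1 + 3 * k := by linarith
  obtain ⟨a, ha⟩ := Finite.exists_min v
  obtain ⟨b, hb⟩ := Finite.exists_max v
  have hma : m ≤ v a := by
    have e := key a
    have p1 := mul_le_mul_of_nonneg_left (ha (a - 1)) h1
    have p2 := mul_le_mul_of_nonneg_left (ha (a + 1)) h1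
    have p3 := mul_le_mul_of_nonneg_left (hu (a - 1)).1 h3
    have p4 := mul_le_mul_of_nonneg_left (hu (a + 1)).1 h3
    have p5 := mul_le_mul_of_nonneg_left (hu a).1 h2
    linarith
  have hMb : v b ≤ M := by
    have e := key b
    have p1 := mul_le_mul_of_nonneg_left (hb (b - 1)) h1
    have p2 := mul_le_mul_of_nonneg_left (hb (b + 1)) h1
    have p3 := mul_le_mul_of_nonneg_left (hu (b - 1)).2 h3
    have p4 := mul_le_mul_of_nonneg_left (hu (b + 1)).2 h3
    have p5 := mul_le_mul_of_nonneg_left (hu b).2 h2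
    linarith
  exact fun i => ⟨hma.trans (ha i), (hb i).trans hMb⟩
end

section
/- Let f : ℝ → ℝ be differentiable with λ·|f′(x)| ≤ 1/3 for all x ∈ [m, M], where λ = τ/h. If u : ZMod N → ℝ satisfies m ≤ u(i) ≤ M for all i, then for every i, m ≤ (B u)(i) − τ·(D(f∘u))(i) ≤ M; explicitly, m ≤ (1/6)u(i−1) + (2/3)u(i) + (1/6)u(i+1) − (λ/2)(f(u(i+1)) − f(u(i−1))) ≤ M. -/
theorem convection_forward_euler_bound_preserving
    (N : ℕ) [NeZero N] (h τ m M : ℝ) (hh : 0 < h) (hτ : 0 < τ)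
    (f : ℝ → ℝ) (hf : Differentiable ℝ f)
    (hCFL : ∀ x ∈ Set.Icc m M, (τ / h) * |deriv f x| ≤ 1 / 3)
    (u : ZMod N → ℝ) (hu : ∀ i : ZMod N, m ≤ u i ∧ u i ≤ M) :
    ∀ i : ZMod N,
      (m ≤ Bop u i - τ * Dop h (fun j => f (u j)) i ∧
        Bop u i - τ * Dop h (fun j => f (u j)) i ≤ M) ∧
      (m ≤ (1 / 6) * u (i - 1) + (2 / 3) * u i + (1 / 6) * u (i + 1)
            - ((τ / h) / 2) * (f (u (i + 1)) - f (u (i - 1))) ∧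
        (1 / 6) * u (i - 1) + (2 / 3) * u i + (1 / 6) * u (i + 1)
            - ((τ / h) / 2) * (f (u (i + 1)) - f (u (i - 1))) ≤ M) := by
  intro i
  have hl : 0 < τ / h := div_pos hτ hh
  have key : |f (u (i + 1)) - f (u (i - 1))| ≤ (1 / 3 / (τ / h)) * |u (i + 1) - u (i - 1)| := by
    have := Convex.norm_image_sub_le_of_norm_deriv_le (𝕜 := ℝ) (f := f) (s := Set.Icc m M)
      (C := 1 / 3 / (τ / h)) (fun x _ => hf x)
      (fun x hx => by
        rw [Real.norm_eq_abs, le_div_iff₀ hl, mul_comm]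
        exact hCFL x hx)
      (convex_Icc m M) (hu (i - 1)) (hu (i + 1))
    simpa only [Real.norm_eq_abs] using this
  have key2 : (τ / h) * |f (u (i + 1)) - f (u (i - 1))| ≤ (1 / 3) * |u (i + 1) - u (i - 1)| := by
    calc _ ≤ (τ / h) * ((1 / 3 / (τ / h)) * |u (i + 1) - u (i - 1)|) :=
          mul_le_mul_of_nonneg_left key hl.le
      _ = _ := by
          rw [← mul_assoc, mul_div_cancel₀ _ hl.ne']
  rw [← abs_of_pos hl, ← abs_mul] at key2
  obtain ⟨k1, k2⟩ := abs_le.mp key2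
  have e : Bop u i - τ * Dop h (fun j => f (u j)) i =
      (1 / 6) * u (i - 1) + (2 / 3) * u i + (1 / 6) * u (i + 1)
            - ((τ / h) / 2) * (f (u (i + 1)) - f (u (i - 1))) := by
    simp only [Bop, Dop]
    field_simp
    ring
  rw [e, and_self]
  obtain ⟨a1, a2⟩ := hu (i - 1)
  obtain ⟨b1, b2⟩ := hu i
  obtain ⟨c1, c2⟩ := hu (i + 1)
  rcases abs_cases (u (i + 1) - u (i - 1)) with ⟨h1, h2⟩ | ⟨h1, h2⟩ <;> rw [h1] at k1 k2 <;>
    constructor <;> linarith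
end

section
/- Let f : ℝ → ℝ be differentiable with λ·|f′(x)| ≤ 1/3 for all x ∈ [m, M], where λ = τ/h. If v, w : ZMod N → ℝ satisfy m ≤ v(i) ≤ M and m ≤ w(i) ≤ M for all i, then for every i, m ≤ (1/2)(B v)(i) + (1/2)·((B w)(i) − τ·(D(f∘w))(i)) ≤ M (the second SSP Runge–Kutta stage of the convection step is bound-preserving). -/
theorem convection_ssp_rk2_second_stage_bound_preserving
    (N : ℕ) [NeZero N] (h τ m M : ℝ) (hh : 0 < h) (hτ : 0 < τ)
    (f : ℝ → ℝ) (hf : Differentiable ℝ f)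
    (hCFL : ∀ x ∈ Set.Icc m M, (τ / h) * |deriv f x| ≤ 1 / 3)
    (v w : ZMod N → ℝ)
    (hv : ∀ i : ZMod N, m ≤ v i ∧ v i ≤ M)
    (hw : ∀ i : ZMod N, m ≤ w i ∧ w i ≤ M) :
    ∀ i : ZMod N,
      m ≤ (1 / 2) * Bop v i + (1 / 2) * (Bop w i - τ * Dop h (fun j => f (w j)) i) ∧
      (1 / 2) * Bop v i + (1 / 2) * (Bop w i - τ * Dop h (fun j => f (w j)) i) ≤ M := by
  intro i
  obtain ⟨hv1, hv1'⟩ := hv (i - 1)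
  obtain ⟨hv2, hv2'⟩ := hv i
  obtain ⟨hv3, hv3'⟩ := hv (i + 1)
  obtain ⟨hw1, hw1'⟩ := hw (i - 1)
  obtain ⟨hw2, hw2'⟩ := hw i
  obtain ⟨hw3, hw3'⟩ := hw (i + 1)
  have hl : 0 < τ / h := div_pos hτ hh
  have key : ‖f (w (i + 1)) - f (w (i - 1))‖ ≤
      ((1 / 3) / (τ / h)) * ‖w (i + 1) - w (i - 1)‖ := by
    apply (convex_Icc m M).norm_image_sub_le_of_norm_deriv_le (𝕜 := ℝ)
    · intro x _
      exact hf x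
    · intro x hx
      rw [le_div_iff₀ hl, Real.norm_eq_abs, mul_comm]
      exact hCFL x hx
    · exact ⟨hw1, hw1'⟩
    · exact ⟨hw3, hw3'⟩
  rw [Real.norm_eq_abs, Real.norm_eq_abs] at key
  have key2 : |τ / h * (f (w (i + 1)) - f (w (i - 1)))| ≤
      1 / 3 * |w (i + 1) - w (i - 1)| := by
    rw [abs_mul, abs_of_pos hl]
    calc _ ≤ τ / h * (((1 / 3) / (τ / h)) * |w (i + 1) - w (i - 1)|) :=
          mul_le_mul_of_nonneg_left key hl.le
      _ = _ := by field_simp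
  have e : τ * Dop h (fun j => f (w j)) i
      = (τ / h * (f (w (i + 1)) - f (w (i - 1)))) / 2 := by
    unfold Dop
    field_simp
  rw [e]
  unfold Bop
  generalize τ / h * (f (w (i + 1)) - f (w (i - 1))) = g at key2
  obtain ⟨k1, k2⟩ := abs_le.mp key2
  rcases abs_cases (w (i + 1) - w (i - 1)) with ⟨h1, _⟩ | ⟨h1, _⟩ <;> rw [h1] at k1 k2 <;>
    constructor <;> linarith
end

section
/- For every ν > 0, τ > 0, h > 0 and every periodic grid function u : ZMod N → ℝ with u not identically zero, Σ_i u(i)·(H₁ u)(i) > 0; that is, the compact Crank–Nicolson diffusion operator H₁ is (symmetric and) positive definite, hence invertible. -/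
theorem H1_positive_definite
    (N : ℕ) [NeZero N] (h τ ν : ℝ) (hh : 0 < h) (hτ : 0 < τ) (hν : 0 < ν)
    (u : ZMod N → ℝ) (hu : u ≠ 0) :
    0 < ∑ i : ZMod N, u i * H1op ν τ h u i := by
  have e1 : ∑ i : ZMod N, u (i + 1) ^ 2 = ∑ i : ZMod N, u i ^ 2 :=
    Equiv.sum_comp (Equiv.addRight (1 : ZMod N)) (fun i => u i ^ 2)
  have e2 : ∑ i : ZMod N, u i * u (i - 1) = ∑ i : ZMod N, u i * u (i + 1) := by
    rw [← Equiv.sum_comp (Equiv.addRight (1 : ZMod N)) (fun i => u i * u (i - 1))]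
    refine Finset.sum_congr rfl fun i _ => ?_
    simp [mul_comm]
  have hS : 0 < ∑ i : ZMod N, u i ^ 2 := by
    obtain ⟨j, hj⟩ := Function.ne_iff.mp hu
    have hj' : u j ≠ 0 := hj
    exact Finset.sum_pos' (fun i _ => sq_nonneg _) ⟨j, Finset.mem_univ _, by positivity⟩
  have p1 : 0 ≤ ∑ i : ZMod N, (u i + u (i + 1)) ^ 2 :=
    Finset.sum_nonneg fun i _ => sq_nonneg _
  have p2 : 0 ≤ ∑ i : ZMod N, (u i - u (i + 1)) ^ 2 :=
    Finset.sum_nonneg fun i _ => sq_nonneg _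
  have q1 : ∑ i : ZMod N, (u i + u (i + 1)) ^ 2 = ∑ i : ZMod N, u i ^ 2
      + 2 * ∑ i : ZMod N, u i * u (i + 1) + ∑ i : ZMod N, u (i + 1) ^ 2 := by
    rw [Finset.mul_sum, ← Finset.sum_add_distrib, ← Finset.sum_add_distrib]
    exact Finset.sum_congr rfl fun i _ => by ring
  have q2 : ∑ i : ZMod N, (u i - u (i + 1)) ^ 2 = ∑ i : ZMod N, u i ^ 2
      - 2 * ∑ i : ZMod N, u i * u (i + 1) + ∑ i : ZMod N, u (i + 1) ^ 2 := by
    rw [Finset.mul_sum, ← Finset.sum_sub_distrib, ← Finset.sum_add_distrib]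
    exact Finset.sum_congr rfl fun i _ => by ring
  obtain ⟨c, hc⟩ : ∃ c : ℝ, c = ν * τ / 4 / h ^ 2 := ⟨_, rfl⟩
  have hc0 : 0 < c := by rw [hc]; positivity
  have key : ∑ i : ZMod N, u i * H1op ν τ h u i
      = (1 / 12 - c) * ∑ i : ZMod N, u i * u (i - 1)
        + (10 / 12 + 2 * c) * ∑ i : ZMod N, u i ^ 2
        + (1 / 12 - c) * ∑ i : ZMod N, u i * u (i + 1) := by
    rw [Finset.mul_sum, Finset.mul_sum, Finset.mul_sum, ← Finset.sum_add_distrib,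
      ← Finset.sum_add_distrib]
    refine Finset.sum_congr rfl fun i _ => ?_
    simp only [H1op, Aop, d2op, hc]
    ring
  rw [key, e2]
  rw [q1, e1] at p1
  rw [q2, e1] at p2
  have := mul_nonneg hc0.le p2
  nlinarith
end

section
/- Suppose f, g : ℝ → ℝ, and for each n ∈ {0,…,Nt−1} the two-dimensional periodic grid functions u⁰, uⁿ, uⁿ¹, uⁿ², uⁿ³, uⁿ⁴, uⁿ⁵, uⁿ⁺¹ and source values Sⁿ satisfy the Strang-ADI-HOC scheme: (i) H₁ₓ A_y uⁿ¹ = (A_x A_y + (ντ/4)·A_y δ_x² + (ντ/2)·A_x δ_y²) uⁿ; (ii) H₁ᵧ uⁿ² = A_y uⁿ¹ − (ντ/4)·δ_y² uⁿ; (iii) B_x B_y uⁿ³ = B_x B_y uⁿ² − τ·B_y D_x(f∘uⁿ²) − τ·B_x D_y(g∘uⁿ²) + τ·B_x B_y Sⁿ; (iv) B_x B_y uⁿ⁴ = B_x B_y uⁿ² − (τ/2)·B_y D_x(f∘uⁿ² + f∘uⁿ³) − (τ/2)·B_x D_y(g∘uⁿ² + g∘uⁿ³) + (τ/2)·B_x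 B_y(Sⁿ + Sⁿ⁺¹); (v) H₁ₓ A_y uⁿ⁵ = (A_x A_y + (ντ/4)·A_y δ_x² + (ντ/2)·A_x δ_y²) uⁿ⁴; (vi) H₁ᵧ uⁿ⁺¹ = A_y uⁿ⁵ − (ντ/4)·δ_y² uⁿ⁴. Then for every n ∈ {0,…,Nt−1}, Σ_{i,j} hx·hy·uⁿ⁺¹(i,j) = Σ_{i,j} hx·hy·u⁰(i,j) + (τ/2)·Σ_{k=0}^{n} Σ_{i,j} hx·hy·(Sᵏ(i,j) + Sᵏ⁺¹(i,j)) (discrete mass conservation in two dimensions). -/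
noncomputable def Ax {Nx Ny : ℕ} (u : ZMod Nx × ZMod Ny → ℝ) : ZMod Nx × ZMod Ny → ℝ :=
  fun p => (u (p.1 - 1, p.2) + 10 * u p + u (p.1 + 1, p.2)) / 12

noncomputable def Ay {Nx Ny : ℕ} (u : ZMod Nx × ZMod Ny → ℝ) : ZMod Nx × ZMod Ny → ℝ :=
  fun p => (u (p.1, p.2 - 1) + 10 * u p + u (p.1, p.2 + 1)) / 12

noncomputable def Bx {Nx Ny : ℕ} (u : ZMod Nx × ZMod Ny → ℝ) : ZMod Nx × ZMod Ny → ℝ :=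
  fun p => (u (p.1 - 1, p.2) + 4 * u p + u (p.1 + 1, p.2)) / 6

noncomputable def By {Nx Ny : ℕ} (u : ZMod Nx × ZMod Ny → ℝ) : ZMod Nx × ZMod Ny → ℝ :=
  fun p => (u (p.1, p.2 - 1) + 4 * u p + u (p.1, p.2 + 1)) / 6

noncomputable def d2x {Nx Ny : ℕ} (hx : ℝ) (u : ZMod Nx × ZMod Ny → ℝ) : ZMod Nx × ZMod Ny → ℝ :=
  fun p => (u (p.1 + 1, p.2) - 2 * u p + u (p.1 - 1, p.2)) / hx ^ 2

noncomputable def d2y {Nx Ny : ℕ} (hy : ℝ) (u : ZMod Nx × ZMod Ny → ℝ) : ZMod Nx × ZMod Ny → ℝ :=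
  fun p => (u (p.1, p.2 + 1) - 2 * u p + u (p.1, p.2 - 1)) / hy ^ 2

noncomputable def Dx {Nx Ny : ℕ} (hx : ℝ) (u : ZMod Nx × ZMod Ny → ℝ) : ZMod Nx × ZMod Ny → ℝ :=
  fun p => (u (p.1 + 1, p.2) - u (p.1 - 1, p.2)) / (2 * hx)

noncomputable def Dy {Nx Ny : ℕ} (hy : ℝ) (u : ZMod Nx × ZMod Ny → ℝ) : ZMod Nx × ZMod Ny → ℝ :=
  fun p => (u (p.1, p.2 + 1) - u (p.1, p.2 - 1)) / (2 * hy)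

noncomputable def H1x {Nx Ny : ℕ} (ν τ hx : ℝ) (u : ZMod Nx × ZMod Ny → ℝ) : ZMod Nx × ZMod Ny → ℝ :=
  fun p => Ax u p - (ν * τ / 4) * d2x hx u p

noncomputable def H1y {Nx Ny : ℕ} (ν τ hy : ℝ) (u : ZMod Nx × ZMod Ny → ℝ) : ZMod Nx × ZMod Ny → ℝ :=
  fun p => Ay u p - (ν * τ / 4) * d2y hy u p

section Helpers

variable {Nx Ny : ℕ} [NeZero Nx] [NeZero Ny]

lemma sum_xp (u : ZMod Nx × ZMod Ny → ℝ) : ∑ p : ZMod Nx × ZMod Ny, u (p.1 + 1, p.2) = ∑ p, u p :=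
  Equiv.sum_comp ((Equiv.addRight (1 : ZMod Nx)).prodCongr (Equiv.refl (ZMod Ny))) u

lemma sum_xm (u : ZMod Nx × ZMod Ny → ℝ) : ∑ p : ZMod Nx × ZMod Ny, u (p.1 - 1, p.2) = ∑ p, u p :=
  Equiv.sum_comp ((Equiv.subRight (1 : ZMod Nx)).prodCongr (Equiv.refl (ZMod Ny))) u

lemma sum_yp (u : ZMod Nx × ZMod Ny → ℝ) : ∑ p : ZMod Nx × ZMod Ny, u (p.1, p.2 + 1) = ∑ p, u p :=
  Equiv.sum_comp ((Equiv.refl (ZMod Nx)).prodCongr (Equiv.addRight (1 : ZMod Ny))) u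

lemma sum_ym (u : ZMod Nx × ZMod Ny → ℝ) : ∑ p : ZMod Nx × ZMod Ny, u (p.1, p.2 - 1) = ∑ p, u p :=
  Equiv.sum_comp ((Equiv.refl (ZMod Nx)).prodCongr (Equiv.subRight (1 : ZMod Ny))) u

lemma sum_Ax (u : ZMod Nx × ZMod Ny → ℝ) : ∑ p, Ax u p = ∑ p, u p := by
  simp only [Ax, ← Finset.sum_div, Finset.sum_add_distrib, Finset.sum_sub_distrib, ← Finset.mul_sum, sum_xp, sum_xm]
  ring

lemma sum_Ay (u : ZMod Nx × ZMod Ny → ℝ) : ∑ p, Ay u p = ∑ p, u p := by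
  simp only [Ay, ← Finset.sum_div, Finset.sum_add_distrib, Finset.sum_sub_distrib, ← Finset.mul_sum, sum_yp, sum_ym]
  ring

lemma sum_Bx (u : ZMod Nx × ZMod Ny → ℝ) : ∑ p, Bx u p = ∑ p, u p := by
  simp only [Bx, ← Finset.sum_div, Finset.sum_add_distrib, Finset.sum_sub_distrib, ← Finset.mul_sum, sum_xp, sum_xm]
  ring

lemma sum_By (u : ZMod Nx × ZMod Ny → ℝ) : ∑ p, By u p = ∑ p, u p := by
  simp only [By, ← Finset.sum_div, Finset.sum_add_distrib, Finset.sum_sub_distrib, ← Finset.mul_sum, sum_yp, sum_ym]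
  ring

lemma sum_d2x (h : ℝ) (u : ZMod Nx × ZMod Ny → ℝ) : ∑ p, d2x h u p = 0 := by
  simp only [d2x, ← Finset.sum_div, Finset.sum_add_distrib, Finset.sum_sub_distrib, ← Finset.mul_sum, sum_xp, sum_xm]
  ring

lemma sum_d2y (h : ℝ) (u : ZMod Nx × ZMod Ny → ℝ) : ∑ p, d2y h u p = 0 := by
  simp only [d2y, ← Finset.sum_div, Finset.sum_add_distrib, Finset.sum_sub_distrib, ← Finset.mul_sum, sum_yp, sum_ym]
  ring

lemma sum_Dx (h : ℝ) (u : ZMod Nx × ZMod Ny → ℝ) : ∑ p, Dx h u p = 0 := by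
  simp only [Dx, ← Finset.sum_div, Finset.sum_add_distrib, Finset.sum_sub_distrib, ← Finset.mul_sum, sum_xp, sum_xm]
  ring

lemma sum_Dy (h : ℝ) (u : ZMod Nx × ZMod Ny → ℝ) : ∑ p, Dy h u p = 0 := by
  simp only [Dy, ← Finset.sum_div, Finset.sum_add_distrib, Finset.sum_sub_distrib, ← Finset.mul_sum, sum_yp, sum_ym]
  ring

lemma sum_diffusion (ν τ hx hy : ℝ) (a b c : ZMod Nx × ZMod Ny → ℝ)
    (h1 : ∀ p, H1x ν τ hx (Ay b) p
        = Ax (Ay a) p + (ν * τ / 4) * Ay (d2x hx a) p + (ν * τ / 2) * Ax (d2y hy a) p)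
    (h2 : ∀ p, H1y ν τ hy c p = Ay b p - (ν * τ / 4) * d2y hy a p) :
    ∑ p, c p = ∑ p, a p := by
  simp only [H1x] at h1
  simp only [H1y] at h2
  have e1 := Finset.sum_congr (rfl : (Finset.univ : Finset (ZMod Nx × ZMod Ny)) = _)
    (fun p _ => h1 p)
  have e2 := Finset.sum_congr (rfl : (Finset.univ : Finset (ZMod Nx × ZMod Ny)) = _)
    (fun p _ => h2 p)
  simp only [Finset.sum_add_distrib, Finset.sum_sub_distrib, ← Finset.mul_sum,
    sum_Ax, sum_Ay, sum_d2x, sum_d2y] at e1 e2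
  linarith

end Helpers

theorem strang_adi_hoc_discrete_mass_conservation_2d
    (Nx Ny Nt : ℕ) [NeZero Nx] [NeZero Ny] (hNt : 0 < Nt)
    (hx hy τ ν : ℝ) (hhx : 0 < hx) (hhy : 0 < hy) (hτ : 0 < τ) (hν : 0 < ν)
    (f g : ℝ → ℝ)
    (u u1 u2 u3 u4 u5 S : ℕ → ZMod Nx × ZMod Ny → ℝ)
    (hstep1 : ∀ n < Nt, ∀ p : ZMod Nx × ZMod Ny,
      H1x ν τ hx (Ay (u1 n)) p
        = Ax (Ay (u n)) p + (ν * τ / 4) * Ay (d2x hx (u n)) p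
          + (ν * τ / 2) * Ax (d2y hy (u n)) p)
    (hstep2 : ∀ n < Nt, ∀ p : ZMod Nx × ZMod Ny,
      H1y ν τ hy (u2 n) p = Ay (u1 n) p - (ν * τ / 4) * d2y hy (u n) p)
    (hstep3 : ∀ n < Nt, ∀ p : ZMod Nx × ZMod Ny,
      Bx (By (u3 n)) p
        = Bx (By (u2 n)) p - τ * By (Dx hx (fun q => f (u2 n q))) p
          - τ * Bx (Dy hy (fun q => g (u2 n q))) p + τ * Bx (By (S n)) p)
    (hstep4 : ∀ n < Nt, ∀ p : ZMod Nx × ZMod Ny,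
      Bx (By (u4 n)) p
        = Bx (By (u2 n)) p
          - (τ / 2) * By (Dx hx (fun q => f (u2 n q) + f (u3 n q))) p
          - (τ / 2) * Bx (Dy hy (fun q => g (u2 n q) + g (u3 n q))) p
          + (τ / 2) * Bx (By (fun q => S n q + S (n + 1) q)) p)
    (hstep5 : ∀ n < Nt, ∀ p : ZMod Nx × ZMod Ny,
      H1x ν τ hx (Ay (u5 n)) p
        = Ax (Ay (u4 n)) p + (ν * τ / 4) * Ay (d2x hx (u4 n)) p
          + (ν * τ / 2) * Ax (d2y hy (u4 n)) p)
    (hstep6 : ∀ n < Nt, ∀ p : ZMod Nx × ZMod Ny,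
      H1y ν τ hy (u (n + 1)) p = Ay (u5 n) p - (ν * τ / 4) * d2y hy (u4 n) p) :
    ∀ n < Nt,
      ∑ p : ZMod Nx × ZMod Ny, hx * hy * u (n + 1) p
        = ∑ p : ZMod Nx × ZMod Ny, hx * hy * u 0 p
          + (τ / 2) * ∑ k ∈ Finset.range (n + 1),
              ∑ p : ZMod Nx × ZMod Ny, hx * hy * (S k p + S (k + 1) p) := by
  have key : ∀ n < Nt, ∑ p, u (n + 1) p
      = ∑ p, u n p + (τ / 2) * ∑ p, (S n p + S (n + 1) p) := by
    intro n hn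
    have e1 := sum_diffusion ν τ hx hy _ _ _ (hstep1 n hn) (hstep2 n hn)
    have e2 := sum_diffusion ν τ hx hy _ _ _ (hstep5 n hn) (hstep6 n hn)
    have e3 := Finset.sum_congr (rfl : (Finset.univ : Finset (ZMod Nx × ZMod Ny)) = _)
      (fun p _ => hstep4 n hn p)
    rw [Finset.sum_add_distrib, Finset.sum_sub_distrib, Finset.sum_sub_distrib,
      ← Finset.mul_sum, ← Finset.mul_sum, ← Finset.mul_sum] at e3
    simp only [sum_Bx, sum_By, sum_Dx, sum_Dy] at e3
    linarith
  intro n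
  induction n with
  | zero =>
    intro hn
    have := key 0 hn
    simp only [← Finset.mul_sum, Finset.sum_range_one, Finset.range_one, zero_add] at this ⊢
    rw [this]
    simp
    ring
  | succ k ih =>
    intro hn
    have h1 := key (k + 1) hn
    have h2 := ih (by omega)
    rw [Finset.sum_range_succ, mul_add, ← add_assoc, ← h2]
    simp only [← Finset.mul_sum]
    rw [h1]
    ring
end

section
/- Set μ₁ = τ/hx², μ₂ = τ/hy², and suppose ν·μ₁ = ν·μ₂ ≤ 5/3. If the two-dimensional periodic grid function u satisfies m ≤ u(i,j) ≤ M for all (i,j), then for every (i,j), m ≤ [(A_x A_y + (ντ/4)·A_y δ_x² + (ντ/2)·A_x δ_y²) u − (ντ/4)·H₁ₓ δ_y² u](i,j) ≤ M; that is, the nine-point stencil defining the ADI diffusion step value H₁ₓ H₁ᵧ uⁿ² is a monotone map of the neighboring values and is bound-preserving. -/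
lemma three_point_bound (s m M x y z : ℝ) (h0 : 0 ≤ s) (h1 : s ≤ 5 / 12)
    (hx : m ≤ x ∧ x ≤ M) (hy : m ≤ y ∧ y ≤ M) (hz : m ≤ z ∧ z ≤ M) :
    m ≤ (1 / 12 + s) * x + (10 / 12 - 2 * s) * y + (1 / 12 + s) * z ∧
      (1 / 12 + s) * x + (10 / 12 - 2 * s) * y + (1 / 12 + s) * z ≤ M := by
  have ha : 0 ≤ 1 / 12 + s := by linarith
  have hc : 0 ≤ 10 / 12 - 2 * s := by linarith
  constructor
  · have e1 := mul_le_mul_of_nonneg_left hx.1 ha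
    have e2 := mul_le_mul_of_nonneg_left hy.1 hc
    have e3 := mul_le_mul_of_nonneg_left hz.1 ha
    linarith
  · have e1 := mul_le_mul_of_nonneg_left hx.2 ha
    have e2 := mul_le_mul_of_nonneg_left hy.2 hc
    have e3 := mul_le_mul_of_nonneg_left hz.2 ha
    linarith

theorem adi_diffusion_stencil_bound_preserving
    (Nx Ny : ℕ) [NeZero Nx] [NeZero Ny]
    (hx hy τ ν m M : ℝ) (hhx : 0 < hx) (hhy : 0 < hy) (hτ : 0 < τ) (hν : 0 < ν)
    (hμeq : ν * (τ / hx ^ 2) = ν * (τ / hy ^ 2))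
    (hμle : ν * (τ / hx ^ 2) ≤ 5 / 3)
    (u : ZMod Nx × ZMod Ny → ℝ)
    (hu : ∀ p : ZMod Nx × ZMod Ny, m ≤ u p ∧ u p ≤ M) :
    ∀ p : ZMod Nx × ZMod Ny,
      m ≤ Ax (Ay u) p + (ν * τ / 4) * Ay (d2x hx u) p
            + (ν * τ / 2) * Ax (d2y hy u) p
            - (ν * τ / 4) * H1x ν τ hx (d2y hy u) p ∧
      Ax (Ay u) p + (ν * τ / 4) * Ay (d2x hx u) p
            + (ν * τ / 2) * Ax (d2y hy u) p
            - (ν * τ / 4) * H1x ν τ hx (d2y hy u) p ≤ M := by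
  rintro ⟨i, j⟩
  obtain ⟨s, hs⟩ : ∃ s, s = ν * (τ / hx ^ 2) / 4 := ⟨_, rfl⟩
  have h0 : 0 ≤ s := by rw [hs]; positivity
  have h1 : s ≤ 5 / 12 := by linarith
  have hw : ∀ k : ZMod Nx, _ := fun k =>
    three_point_bound s m M (u (k, j - 1)) (u (k, j)) (u (k, j + 1)) h0 h1 (hu _) (hu _) (hu _)
  have key := three_point_bound s m M _ _ _ h0 h1 (hw (i - 1)) (hw i) (hw (i + 1))
  have ex : (hx ^ 2)⁻¹ * (ν * τ) = 4 * s := by rw [hs]; ring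
  have ey : (hy ^ 2)⁻¹ * (ν * τ) = 4 * s := by rw [hs, hμeq]; ring
  obtain ⟨X, hX⟩ : ∃ X, X = (hx ^ 2)⁻¹ := ⟨_, rfl⟩
  obtain ⟨Y, hY⟩ : ∃ Y, Y = (hy ^ 2)⁻¹ := ⟨_, rfl⟩
  obtain ⟨k, hk⟩ : ∃ k, k = ν * τ := ⟨_, rfl⟩
  have hk0 : k ≠ 0 := by rw [hk]; positivity
  simp only [H1x, Ax, Ay, d2x, d2y, div_eq_mul_inv _ (hx ^ 2), div_eq_mul_inv _ (hy ^ 2)]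
  rw [← hX, ← hk] at ex
  rw [← hY, ← hk] at ey
  rw [← hX, ← hY, ← hk]
  have hX' : X = 4 * s / k := by field_simp; linarith
  have hY' : Y = 4 * s / k := by field_simp; linarith
  rw [hX', hY']
  convert key using 2 <;> (field_simp; ring)
end

section
/- Set μ₁ = τ/hx², μ₂ = τ/hy², and suppose ν·μ₁ ≥ 1/3 and ν·μ₂ ≥ 1/3. If the two-dimensional periodic grid functions u, w satisfy H₁ₓ(H₁ᵧ u) = w and m ≤ w(i,j) ≤ M for all (i,j), then m ≤ u(i,j) ≤ M for all (i,j) (inverting the two one-directional compact diffusion operators preserves the bounds in this regime). -/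
theorem helper_bound {α : Type*} [Finite α] [Nonempty α] (s t : α → α) (c m M : ℝ) (hc : 0 ≤ c)
    (v w : α → ℝ) (h : ∀ p, v p + c * (2 * v p - v (s p) - v (t p)) = w p)
    (hw : ∀ p, m ≤ w p ∧ w p ≤ M) : ∀ p, m ≤ v p ∧ v p ≤ M := by
  obtain ⟨a, ha⟩ := Finite.exists_min v
  obtain ⟨b, hb⟩ := Finite.exists_max v
  intro p
  constructor
  · have h1 : 0 ≤ c * (v (s a) + v (t a) - 2 * v a) :=
      mul_nonneg hc (by linarith [ha (s a), ha (t a)])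
    linarith [h a, (hw a).1, ha p]
  · have h1 : 0 ≤ c * (2 * v b - v (s b) - v (t b)) :=
      mul_nonneg hc (by linarith [hb (s b), hb (t b)])
    linarith [h b, (hw b).2, hb p]

theorem adi_diffusion_inverse_bound_preserving
    (Nx Ny : ℕ) [NeZero Nx] [NeZero Ny]
    (hx hy τ ν m M : ℝ) (hhx : 0 < hx) (hhy : 0 < hy) (hτ : 0 < τ) (hν : 0 < ν)
    (hμ1 : 1 / 3 ≤ ν * (τ / hx ^ 2)) (hμ2 : 1 / 3 ≤ ν * (τ / hy ^ 2))
    (u w : ZMod Nx × ZMod Ny → ℝ)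
    (hscheme : ∀ p : ZMod Nx × ZMod Ny, H1x ν τ hx (H1y ν τ hy u) p = w p)
    (hw : ∀ p : ZMod Nx × ZMod Ny, m ≤ w p ∧ w p ≤ M) :
    ∀ p : ZMod Nx × ZMod Ny, m ≤ u p ∧ u p ≤ M := by
  have key := helper_bound (fun p : ZMod Nx × ZMod Ny => (p.1 - 1, p.2))
    (fun p => (p.1 + 1, p.2)) (ν * (τ / hx ^ 2) / 4 - 1 / 12) m M (by linarith)
    (H1y ν τ hy u) w (fun p => by
      rw [← hscheme p]
      simp only [H1x, Ax, d2x]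
      ring) hw
  exact helper_bound (fun p : ZMod Nx × ZMod Ny => (p.1, p.2 - 1))
    (fun p => (p.1, p.2 + 1)) (ν * (τ / hy ^ 2) / 4 - 1 / 12) m M (by linarith)
    u (H1y ν τ hy u) (fun p => by
      simp only [H1y, Ay, d2y]
      ring) key
end

section
/- Set λ₁ = τ/hx, λ₂ = τ/hy, and let f, g : ℝ → ℝ be differentiable with λ₁·|f′(x)| + λ₂·|g′(x)| ≤ 1/3 for all x ∈ [m, M]. If the two-dimensional periodic grid function u satisfies m ≤ u(i,j) ≤ M for all (i,j), then for every (i,j), m ≤ [B_x B_y u − τ·B_y D_x(f∘u) − τ·B_x D_y(g∘u)](i,j) ≤ M (the forward Euler convection stage in two dimensions is bound-preserving at the level of the compact stencil values). -/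
theorem mono_aux (a b m M : ℝ) (ha : 0 < a) (hb : 0 < b)
    (f g : ℝ → ℝ) (hf : Differentiable ℝ f) (hg : Differentiable ℝ g)
    (hCFL : ∀ x ∈ Set.Icc m M, a * |deriv f x| + b * |deriv g x| ≤ 1 / 3)
    (s t : ℝ) (hs : |s| ≤ 1) (ht : |t| ≤ 1) :
    MonotoneOn (fun x => x + s * (3 * (a * f x)) + t * (3 * (b * g x))) (Set.Icc m M) := by
  have hd : ∀ x, HasDerivAt (fun x => x + s * (3 * (a * f x)) + t * (3 * (b * g x)))
      (1 + s * (3 * (a * deriv f x)) + t * (3 * (b * deriv g x))) x := fun x =>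
    ((hasDerivAt_id x).add (((((hf x).hasDerivAt).const_mul a).const_mul 3).const_mul s)).add
      (((((hg x).hasDerivAt).const_mul b).const_mul 3).const_mul t)
  apply monotoneOn_of_deriv_nonneg (convex_Icc m M)
  · exact fun x _ => (hd x).continuousAt.continuousWithinAt
  · exact fun x _ => (hd x).differentiableAt.differentiableWithinAt
  · intro x hx
    rw [(hd x).deriv]
    have h := hCFL x (interior_subset hx)
    have key : ∀ c r : ℝ, |c| ≤ 1 → -|r| ≤ c * r := by
      intro c r hc
      have h1 : |c * r| ≤ |r| := by
        rw [abs_mul]; exact mul_le_of_le_one_left (abs_nonneg r) hc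
      linarith [neg_abs_le (c * r)]
    have h1 := mul_le_mul_of_nonneg_left (key s (deriv f x) hs) ha.le
    have h2 := mul_le_mul_of_nonneg_left (key t (deriv g x) ht) hb.le
    linarith

theorem convection_forward_euler_bound_preserving_2d
    (Nx Ny : ℕ) [NeZero Nx] [NeZero Ny]
    (hx hy τ m M : ℝ) (hhx : 0 < hx) (hhy : 0 < hy) (hτ : 0 < τ)
    (f g : ℝ → ℝ) (hf : Differentiable ℝ f) (hg : Differentiable ℝ g)
    (hCFL : ∀ x ∈ Set.Icc m M,
      (τ / hx) * |deriv f x| + (τ / hy) * |deriv g x| ≤ 1 / 3)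
    (u : ZMod Nx × ZMod Ny → ℝ)
    (hu : ∀ p : ZMod Nx × ZMod Ny, m ≤ u p ∧ u p ≤ M) :
    ∀ p : ZMod Nx × ZMod Ny,
      m ≤ Bx (By u) p - τ * By (Dx hx (fun q => f (u q))) p
            - τ * Bx (Dy hy (fun q => g (u q))) p ∧
      Bx (By u) p - τ * By (Dx hx (fun q => f (u q))) p
            - τ * Bx (Dy hy (fun q => g (u q))) p ≤ M := by
  rintro ⟨i, j⟩
  have mono := mono_aux (τ / hx) (τ / hy) m M (div_pos hτ hhx) (div_pos hτ hhy) f g hf hg hCFL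
  have hmM : m ≤ M := (hu (i, j)).1.trans (hu (i, j)).2
  have lo := fun s t hs ht p =>
    mono s t hs ht (Set.left_mem_Icc.2 hmM) (Set.mem_Icc.2 (hu p)) (hu p).1
  have hi := fun s t hs ht p =>
    mono s t hs ht (Set.mem_Icc.2 (hu p)) (Set.right_mem_Icc.2 hmM) (hu p).2
  have n1 : |(-1 : ℝ)| ≤ 1 := by norm_num
  have n0 : |(0 : ℝ)| ≤ 1 := by norm_num
  have p1 : |(1 : ℝ)| ≤ 1 := by norm_num
  simp only [Bx, By, Dx, Dy]
  constructor
  · have h0 := lo 1 1 p1 p1 (i - 1, j - 1)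
    have h1 := lo 1 0 p1 n0 (i - 1, j)
    have h2 := lo 1 (-1) p1 n1 (i - 1, j + 1)
    have h3 := lo 0 1 n0 p1 (i, j - 1)
    have h4 := lo 0 0 n0 n0 (i, j)
    have h5 := lo 0 (-1) n0 n1 (i, j + 1)
    have h6 := lo (-1) 1 n1 p1 (i + 1, j - 1)
    have h7 := lo (-1) 0 n1 n0 (i + 1, j)
    have h8 := lo (-1) (-1) n1 n1 (i + 1, j + 1)
    simp only [div_eq_mul_inv, mul_inv] at *
    linarith
  · have h0 := hi 1 1 p1 p1 (i - 1, j - 1)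
    have h1 := hi 1 0 p1 n0 (i - 1, j)
    have h2 := hi 1 (-1) p1 n1 (i - 1, j + 1)
    have h3 := hi 0 1 n0 p1 (i, j - 1)
    have h4 := hi 0 0 n0 n0 (i, j)
    have h5 := hi 0 (-1) n0 n1 (i, j + 1)
    have h6 := hi (-1) 1 n1 p1 (i + 1, j - 1)
    have h7 := hi (-1) 0 n1 n0 (i + 1, j)
    have h8 := hi (-1) (-1) n1 n1 (i + 1, j + 1)
    simp only [div_eq_mul_inv, mul_inv] at *
    linarith
end

section
/- Set λ₁ = τ/hx, λ₂ = τ/hy, and let f, g : ℝ → ℝ be differentiable with λ₁·|f′(x)| + λ₂·|g′(x)| ≤ 1/3 for all x ∈ [m, M]. If the two-dimensional periodic grid functions v, w satisfy m ≤ v(i,j) ≤ M and m ≤ w(i,j) ≤ M for all (i,j), then for every (i,j), m ≤ (1/2)·(B_x B_y v)(i,j) + (1/2)·[B_x B_y w − τ·B_y D_x(f∘w) − τ·B_x D_y(g∘w)](i,j) ≤ M (the second SSP Runge–Kutta stage of the two-dimensional convection step is bound-preserving at the level of the compact stencil values). -/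
theorem stage_mono (m M a b l k : ℝ) (hl : 0 ≤ l) (hk : 0 ≤ k) (ha : |a| ≤ 1) (hb : |b| ≤ 1)
    (f g : ℝ → ℝ) (hf : Differentiable ℝ f) (hg : Differentiable ℝ g)
    (hCFL : ∀ x ∈ Set.Icc m M, l * |deriv f x| + k * |deriv g x| ≤ 1 / 3) :
    MonotoneOn (fun x => x + 3 * a * (l * f x) + 3 * b * (k * g x)) (Set.Icc m M) := by
  have hd : ∀ x, HasDerivAt (fun x => x + 3 * a * (l * f x) + 3 * b * (k * g x))
      (1 + 3 * a * (l * deriv f x) + 3 * b * (k * deriv g x)) x := fun x =>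
    ((hasDerivAt_id x).add (((hf x).hasDerivAt.const_mul l).const_mul (3 * a))).add
      (((hg x).hasDerivAt.const_mul k).const_mul (3 * b))
  refine monotoneOn_of_deriv_nonneg (convex_Icc m M)
    (fun x _ => (hd x).continuousAt.continuousWithinAt)
    (fun x _ => (hd x).differentiableAt.differentiableWithinAt) ?_
  intro x hx
  rw [(hd x).deriv]
  have h := hCFL x (interior_subset hx)
  have key : ∀ c d : ℝ, |c| ≤ 1 → -|d| ≤ c * d := fun c d hc => by
    have h1 : |c * d| ≤ |d| := by
      rw [abs_mul]; exact mul_le_of_le_one_left (abs_nonneg d) hc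
    linarith [neg_abs_le (c * d)]
  have h1 := mul_le_mul_of_nonneg_left (key a (deriv f x) ha) hl
  have h2 := mul_le_mul_of_nonneg_left (key b (deriv g x) hb) hk
  linarith

theorem convection_ssp_rk2_second_stage_bound_preserving_2d
    (Nx Ny : ℕ) [NeZero Nx] [NeZero Ny]
    (hx hy τ m M : ℝ) (hhx : 0 < hx) (hhy : 0 < hy) (hτ : 0 < τ)
    (f g : ℝ → ℝ) (hf : Differentiable ℝ f) (hg : Differentiable ℝ g)
    (hCFL : ∀ x ∈ Set.Icc m M,
      (τ / hx) * |deriv f x| + (τ / hy) * |deriv g x| ≤ 1 / 3)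
    (v w : ZMod Nx × ZMod Ny → ℝ)
    (hv : ∀ p : ZMod Nx × ZMod Ny, m ≤ v p ∧ v p ≤ M)
    (hw : ∀ p : ZMod Nx × ZMod Ny, m ≤ w p ∧ w p ≤ M) :
    ∀ p : ZMod Nx × ZMod Ny,
      m ≤ (1 / 2) * Bx (By v) p
            + (1 / 2) * (Bx (By w) p - τ * By (Dx hx (fun q => f (w q))) p
                - τ * Bx (Dy hy (fun q => g (w q))) p) ∧
      (1 / 2) * Bx (By v) p
            + (1 / 2) * (Bx (By w) p - τ * By (Dx hx (fun q => f (w q))) p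
                - τ * Bx (Dy hy (fun q => g (w q))) p) ≤ M := by
  rintro ⟨i, j⟩
  have hmM : m ≤ M := (hw (i, j)).1.trans (hw (i, j)).2
  have key : ∀ a b : ℝ, |a| ≤ 1 → |b| ≤ 1 → ∀ q,
      m + 3 * a * (τ / hx * f m) + 3 * b * (τ / hy * g m)
        ≤ w q + 3 * a * (τ / hx * f (w q)) + 3 * b * (τ / hy * g (w q)) ∧
      w q + 3 * a * (τ / hx * f (w q)) + 3 * b * (τ / hy * g (w q))
        ≤ M + 3 * a * (τ / hx * f M) + 3 * b * (τ / hy * g M) := by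
    intro a b ha hb q
    have h := stage_mono m M a b (τ / hx) (τ / hy) (by positivity) (by positivity) ha hb
      f g hf hg hCFL
    exact ⟨h ⟨le_rfl, hmM⟩ (hw q) (hw q).1, h (hw q) ⟨hmM, le_rfl⟩ (hw q).2⟩
  have e1 := key 1 1 (by simp) (by simp) (i - 1, j - 1)
  have e2 := key 1 (-1) (by simp) (by simp) (i - 1, j + 1)
  have e3 := key (-1) 1 (by simp) (by simp) (i + 1, j - 1)
  have e4 := key (-1) (-1) (by simp) (by simp) (i + 1, j + 1)
  have e5 := key 1 0 (by simp) (by simp) (i - 1, j)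
  have e6 := key (-1) 0 (by simp) (by simp) (i + 1, j)
  have e7 := key 0 1 (by simp) (by simp) (i, j - 1)
  have e8 := key 0 (-1) (by simp) (by simp) (i, j + 1)
  have e9 := hw (i, j)
  have d1 := hv (i - 1, j - 1)
  have d2 := hv (i - 1, j + 1)
  have d3 := hv (i + 1, j - 1)
  have d4 := hv (i + 1, j + 1)
  have d5 := hv (i - 1, j)
  have d6 := hv (i + 1, j)
  have d7 := hv (i, j - 1)
  have d8 := hv (i, j + 1)
  have d9 := hv (i, j)
  have hD : ∀ x y h : ℝ, τ * ((x - y) / (2 * h)) = (τ / h * x - τ / h * y) / 2 := by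
    intro x y h
    rw [div_eq_mul_inv, mul_inv]; ring
  have hB : ∀ x y z : ℝ, τ * ((x + 4 * y + z) / 6) = (τ * x + 4 * (τ * y) + τ * z) / 6 := by
    intro x y z; ring
  simp only [Bx, By, Dx, Dy, hB, hD]
  generalize τ / hx = l at *
  generalize τ / hy = k at *
  constructor <;> linarith
end

section
/- Let λ > 0 and let f : ℝ → ℝ be differentiable with λ·|f′(x)| ≤ 1/3 for all x ∈ [m, M]. Define K(a, b, c) = (1/6)·a + (λ/2)·f(a) + (2/3)·b + (1/6)·c − (λ/2)·f(c). Then K is monotone nondecreasing in each of its three arguments on [m, M]³, and K(m, m, m) = m, K(M, M, M) = M; consequently K maps [m, M]³ into [m, M] (weak monotonicity of the compact convection stencil). -/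
noncomputable def Kstencil (lam : ℝ) (f : ℝ → ℝ) (a b c : ℝ) : ℝ :=
  (1 / 6) * a + (lam / 2) * f a + (2 / 3) * b + (1 / 6) * c - (lam / 2) * f c

theorem lam_diff_bound
    (m M lam : ℝ) (hlam : 0 < lam)
    (f : ℝ → ℝ) (hf : Differentiable ℝ f)
    (hCFL : ∀ x ∈ Set.Icc m M, lam * |deriv f x| ≤ 1 / 3)
    (x y : ℝ) (hx : x ∈ Set.Icc m M) (hy : y ∈ Set.Icc m M) (hxy : x ≤ y) :
    |lam * (f y - f x)| ≤ 1 / 3 * (y - x) := by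
  have h := (convex_Icc m M).norm_image_sub_le_of_norm_deriv_le (f := f)
    (C := 1 / 3 / lam) (fun z _ => hf z)
    (fun z hz => by
      rw [Real.norm_eq_abs, le_div_iff₀ hlam, mul_comm]
      exact hCFL z hz) hx hy
  rw [Real.norm_eq_abs, Real.norm_eq_abs, abs_of_nonneg (sub_nonneg.2 hxy)] at h
  rw [abs_mul, abs_of_pos hlam]
  calc lam * |f y - f x| ≤ lam * (1 / 3 / lam * (y - x)) :=
        mul_le_mul_of_nonneg_left h hlam.le
    _ = 1 / 3 * (y - x) := by field_simp

theorem weak_monotonicity_compact_convection_stencil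
    (m M lam : ℝ) (hmM : m ≤ M) (hlam : 0 < lam)
    (f : ℝ → ℝ) (hf : Differentiable ℝ f)
    (hCFL : ∀ x ∈ Set.Icc m M, lam * |deriv f x| ≤ 1 / 3) :
    (∀ a a' b c : ℝ, a ∈ Set.Icc m M → a' ∈ Set.Icc m M →
        b ∈ Set.Icc m M → c ∈ Set.Icc m M → a ≤ a' →
        Kstencil lam f a b c ≤ Kstencil lam f a' b c) ∧
    (∀ a b b' c : ℝ, a ∈ Set.Icc m M → b ∈ Set.Icc m M →
        b' ∈ Set.Icc m M → c ∈ Set.Icc m M → b ≤ b' →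
        Kstencil lam f a b c ≤ Kstencil lam f a b' c) ∧
    (∀ a b c c' : ℝ, a ∈ Set.Icc m M → b ∈ Set.Icc m M →
        c ∈ Set.Icc m M → c' ∈ Set.Icc m M → c ≤ c' →
        Kstencil lam f a b c ≤ Kstencil lam f a b c') ∧
    Kstencil lam f m m m = m ∧
    Kstencil lam f M M M = M ∧
    (∀ a b c : ℝ, a ∈ Set.Icc m M → b ∈ Set.Icc m M → c ∈ Set.Icc m M →
        Kstencil lam f a b c ∈ Set.Icc m M) := by
  have key := lam_diff_bound m M lam hlam f hf hCFL
  have h1 : ∀ a a' b c : ℝ, a ∈ Set.Icc m M → a' ∈ Set.Icc m M → a ≤ a' →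
      Kstencil lam f a b c ≤ Kstencil lam f a' b c := by
    intro a a' b c ha ha' h
    have := abs_le.1 (key a a' ha ha' h)
    unfold Kstencil
    linarith [this.1]
  have h2 : ∀ a b b' c : ℝ, b ≤ b' →
      Kstencil lam f a b c ≤ Kstencil lam f a b' c := by
    intro a b b' c h
    unfold Kstencil
    linarith
  have h3 : ∀ a b c c' : ℝ, c ∈ Set.Icc m M → c' ∈ Set.Icc m M → c ≤ c' →
      Kstencil lam f a b c ≤ Kstencil lam f a b c' := by
    intro a b c c' hc hc' h
    have := abs_le.1 (key c c' hc hc' h)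
    unfold Kstencil
    linarith [this.2]
  have h4 : ∀ x : ℝ, Kstencil lam f x x x = x := by
    intro x
    unfold Kstencil
    ring
  have hm : m ∈ Set.Icc m M := ⟨le_rfl, hmM⟩
  have hM : M ∈ Set.Icc m M := ⟨hmM, le_rfl⟩
  refine ⟨fun a a' b c ha ha' _ _ h => h1 a a' b c ha ha' h,
    fun a b b' c _ _ _ _ h => h2 a b b' c h,
    fun a b c c' _ _ hc hc' h => h3 a b c c' hc hc' h, h4 m, h4 M, ?_⟩
  intro a b c ha hb hc
  constructor
  · calc m = Kstencil lam f m m m := (h4 m).symm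
      _ ≤ Kstencil lam f a m m := h1 _ _ _ _ hm ha ha.1
      _ ≤ Kstencil lam f a b m := h2 _ _ _ _ hb.1
      _ ≤ Kstencil lam f a b c := h3 _ _ _ _ hm hc hc.1
  · calc Kstencil lam f a b c ≤ Kstencil lam f M b c := h1 _ _ _ _ ha hM ha.2
      _ ≤ Kstencil lam f M M c := h2 _ _ _ _ hb.2
      _ ≤ Kstencil lam f M M M := h3 _ _ _ _ hc hM hc.2
      _ = M := h4 M
end
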